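/- Let k ≥ 3, v ≥ k+1, and let D be a defining set for the full design F(v,k). Then |D| ≥ C(v,k)·[1 − (1 + √((32(v−k)+11)/3))/(2(v−k+1))]; in particular |D| = C(v,k)·(1 − O((v−k)^{−1/2})). -/

import Mathlib

/-- The full design on point set `P` with block size `k`: all `k`-element subsets of `P`. -/
def fullDesignOn {α : Type*} [DecidableEq α] (P : Finset α) (k : ℕ) : Finset (Finset α) :=
  P.powersetCard k

/-- A `(P, k, lam)`-design: a multiset of `k`-element subsets (blocks) of the point set `P`
such that every unordered pair of distinct points of `P` lies in exactly `lam` blocks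
(repeated blocks are allowed). -/
def IsDesignOn {α : Type*} [DecidableEq α] (P : Finset α) (k lam : ℕ)
    (B : Multiset (Finset α)) : Prop :=
  (∀ b ∈ B, b ⊆ P ∧ b.card = k) ∧
  ∀ i ∈ P, ∀ j ∈ P, i ≠ j → Multiset.countP (fun b => i ∈ b ∧ j ∈ b) B = lam

/-- `D` is a defining set for the full design on `P` with block size `k`: `D` is a set of
blocks of the full design, and the only `(P, k, C(|P|−2, k−2))`-design (repeated blocks
allowed) containing `D` is the full design. -/
def IsDefiningSetOn {α : Type*} [DecidableEq α] (P : Finset α) (k : ℕ)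
    (D : Finset (Finset α)) : Prop :=
  D ⊆ fullDesignOn P k ∧
  ∀ B : Multiset (Finset α), IsDesignOn P k ((P.card - 2).choose (k - 2)) B →
    D.val ≤ B → B = (fullDesignOn P k).val


open SimpleGraph in
lemma walk_first_hit {V : Type*} {G : SimpleGraph V} (W : Set V) {y x : V} (p : G.Walk y x)
    (h : ∃ z ∈ p.support, z ∈ W) :
    ∃ a ∈ W, ∃ (p1 : G.Walk y a) (p2 : G.Walk a x), p = p1.append p2 ∧
      ∀ e ∈ p1.edges, ∃ z ∈ e, z ∉ W := by
  induction p with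
  | nil =>
    obtain ⟨z, hz, hW⟩ := h
    simp at hz
    subst hz
    exact ⟨z, hW, .nil, .nil, rfl, by simp⟩
  | @cons u v w hadj p ih =>
    by_cases hu : u ∈ W
    · exact ⟨u, hu, .nil, .cons hadj p, rfl, by simp⟩
    · have h' : ∃ z ∈ p.support, z ∈ W := by
        obtain ⟨z, hz, hW⟩ := h
        simp at hz
        rcases hz with rfl | hz
        · exact absurd hW hu
        · exact ⟨z, hz, hW⟩
      obtain ⟨a, ha, p1, p2, rfl, h1⟩ := ih h'
      refine ⟨a, ha, .cons hadj p1, p2, rfl, ?_⟩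
      intro e he
      simp at he
      rcases he with rfl | he
      · exact ⟨u, by simp, hu⟩
      · exact h1 e he

/-- no even closed trails -/
def NoEvenTrail {V : Type*} (G : SimpleGraph V) : Prop :=
  ∀ (u : V) (p : G.Walk u u), p.IsTrail → 0 < p.length → ¬ Even p.length

open SimpleGraph in
lemma noEven_disjoint {V : Type*} {G : SimpleGraph V} (hG : NoEvenTrail G) {x y z : V}
    (h : G.Adj x y) (q : G.Walk y x) (hq : q.IsTrail) (hxy : s(x, y) ∉ q.edges)
    (Q : G.Walk z z) (hQ : Q.IsTrail) (hxyQ : s(x, y) ∉ Q.edges) (hlen : 0 < Q.length)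
    (t : V) (ht : t ∈ q.support) (htQ : t ∈ Q.support) : False := by
  classical
  obtain ⟨a, ha, p1, p2, rfl, h1⟩ := walk_first_hit {z | z ∈ Q.support} q ⟨t, ht, htQ⟩
  obtain ⟨b, hb, p3, p4, h34, h3⟩ := walk_first_hit {z | z ∈ Q.support} p2.reverse ⟨a, by simp, ha⟩
  simp only [Set.mem_ofPred_eq] at ha hb h1 h3
  have hp2e : ∀ e, p2.edges.count e = p3.edges.count e + p4.edges.count e := by
    intro e
    have := congrArg (fun w => w.edges.count e) h34
    simpa [Walk.edges_append, Walk.edges_reverse] using this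
  have hin : ∀ e ∈ Q.edges, ∀ z ∈ e, z ∈ Q.support := by
    intro e he z hz
    exact Walk.mem_support_of_mem_edges he hz
  have hQo := hG z Q hQ hlen
  set Q' := Q.rotate a ha with hQ'
  have hb' : b ∈ Q'.support := by rw [hQ']; simpa using hb
  have hspec := Q'.take_spec hb'
  set Q1 := Q'.takeUntil b hb'
  set Q2 := Q'.dropUntil b hb'
  have hcQ : ∀ e, Q.edges.count e = Q1.edges.count e + Q2.edges.count e := by
    intro e
    rw [← List.count_append, ← Walk.edges_append, hspec, hQ']
    exact ((Q.rotate_edges a ha).perm.count_eq e).symm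
  have hl : Q.length = Q1.length + Q2.length := by
    rw [← Walk.length_append, hspec, hQ', Walk.length_rotate]
  have key : ∀ (R : G.Walk a b), (∀ e, R.edges.count e ≤ Q.edges.count e) →
      Even (R.length + (1 + p1.length + p3.length)) → False := by
    intro R hR hev
    refine hG x (Walk.cons h (p1.append (R.append p3.reverse))) ?_ (by simp) ?_
    · rw [Walk.isTrail_def, List.nodup_iff_count_le_one] at hq hQ ⊢
      intro e
      simp only [Walk.edges_cons, Walk.edges_append, Walk.edges_reverse, List.count_cons,
        List.count_append, List.count_reverse] at hq hQ ⊢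
      have e1 := hq e
      have e2 := hQ e
      have e3 := hR e
      rw [hp2e] at e1
      have hd : 0 < Q.edges.count e → p1.edges.count e = 0 ∧ p3.edges.count e = 0 := by
        intro hpos
        have hm := List.count_pos_iff.1 hpos
        constructor
        · rw [List.count_eq_zero]
          intro hh
          obtain ⟨z, hz, hzn⟩ := h1 e hh
          exact hzn (hin e hm z hz)
        · rw [List.count_eq_zero]
          intro hh
          obtain ⟨z, hz, hzn⟩ := h3 e hh
          exact hzn (hin e hm z hz)
      have hz : (s(x,y) == e) = true → p1.edges.count e = 0 ∧ p3.edges.count e = 0 ∧ 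
          Q.edges.count e = 0 := by
        intro hh
        have : s(x,y) = e := by simpa using hh
        subst this
        rw [← List.count_eq_zero, Walk.edges_append, List.count_append, hp2e] at hxy
        rw [← List.count_eq_zero] at hxyQ
        omega
      split_ifs with hc
      · have := hz hc
        omega
      · rcases Nat.eq_zero_or_pos (Q.edges.count e) with h0 | h0
        · omega
        · have := hd h0
          omega
    · simp only [Walk.length_cons, Walk.length_append, Walk.length_reverse]
      convert hev using 1
      ring
  rcases Nat.even_or_odd (Q1.length + (1 + p1.length + p3.length)) with he | ho
  · exact key Q1 (fun e => by rw [hcQ]; omega) he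
  · refine key Q2.reverse (fun e => by simp [Walk.edges_reverse, hcQ]) ?_
    rw [Walk.length_reverse]
    rw [hl] at hQo
    grind

open SimpleGraph in
lemma acyclic_card {V : Type*} [Fintype V] [Nonempty V] (G : SimpleGraph V) (hG : G.IsAcyclic) :
    G.edgeSet.ncard + 1 ≤ Fintype.card V := by
  classical
  obtain ⟨T, hT, -, hTt⟩ := (connected_top (V := V)).exists_isTree_le_of_le_of_isAcyclic
    (le_top : G ≤ ⊤) hG
  rw [← hTt.card_edgeFinset]
  have : G.edgeSet.ncard ≤ T.edgeSet.ncard :=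
    Set.ncard_le_ncard (edgeSet_mono hT) (Set.toFinite _)
  rw [← coe_edgeFinset T, Set.ncard_coe_finset] at this
  omega

/-- vertices on a nontrivial closed trail -/
def onTrail {V : Type*} (G : SimpleGraph V) : Set V :=
  {t | ∃ (z : V) (Q : G.Walk z z), Q.IsTrail ∧ 0 < Q.length ∧ t ∈ Q.support}

open SimpleGraph in
lemma noEven_card_aux {V : Type*} [Fintype V] [Nonempty V] (n : ℕ) (G : SimpleGraph V)
    (hn : G.edgeSet.ncard = n) (hG : NoEvenTrail G) :
    3 * G.edgeSet.ncard + 3 ≤ 3 * Fintype.card V + (onTrail G).ncard := by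
  classical
  induction n generalizing G with
  | zero =>
    have := Fintype.card_pos (α := V)
    omega
  | succ n ih =>
    by_cases hac : G.IsAcyclic
    · have := acyclic_card G hac
      omega
    · unfold IsAcyclic at hac
      push Not at hac
      obtain ⟨x, p, hp⟩ := hac
      have h3 := hp.three_le_length
      cases p with
      | nil => simp at h3
      | @cons _ y _ h q =>
        have hpt := hp.isTrail
        rw [Walk.cons_isCycle_iff] at hp
        obtain ⟨hqp, hqe⟩ := hp
        let G' := G.deleteEdges {s(x, y)}
        have hle : G' ≤ G := deleteEdges_le _
        have hes : G'.edgeSet = G.edgeSet \ {s(x, y)} := edgeSet_deleteEdges _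
        have hc : G'.edgeSet.ncard + 1 = G.edgeSet.ncard := by
          rw [hes]
          exact Set.ncard_sdiff_singleton_add_one (by simpa using h) (Set.toFinite _)
        have hG' : NoEvenTrail G' := by
          intro u r hr hl
          have := hG u (r.mapLe hle) (by simpa using hr) (by simpa using hl)
          simpa using this
        have := ih G' (by omega) hG'
        have hsub : onTrail G' ∪ (q.support.toFinset : Set V) ⊆ onTrail G := by
          rintro t (⟨z, Q, hQ, hl, ht⟩ | ht)
          · exact ⟨z, Q.mapLe hle, by simpa using hQ, by simpa using hl, by simpa using ht⟩
          · exact ⟨x, Walk.cons h q, hpt, by simp, by simp at ht; simp [ht]⟩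
        have hdis : Disjoint (onTrail G') (q.support.toFinset : Set V) := by
          rw [Set.disjoint_left]
          rintro t ⟨z, Q, hQ, hl, ht⟩ htq
          refine noEven_disjoint hG h q hqp.isTrail hqe (Q.mapLe hle) (by simpa using hQ) ?_
            (by simpa using hl) t (by simpa using htq) (by simpa using ht)
          rw [Walk.edges_mapLe_eq_edges]
          intro hmem
          have := Q.edges_subset_edgeSet hmem
          rw [hes] at this
          simp at this
        have hcard := Set.ncard_le_ncard hsub (Set.toFinite _)
        rw [Set.ncard_union_eq hdis (Set.toFinite _) (Set.toFinite _), Set.ncard_coe_finset,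
          List.toFinset_card_of_nodup hqp.support_nodup, Walk.length_support] at hcard
        simp at h3
        omega

lemma noEven_card {V : Type*} [Fintype V] [Nonempty V] (G : SimpleGraph V)
    (hG : NoEvenTrail G) :
    3 * G.edgeSet.ncard + 3 ≤ 4 * Fintype.card V := by
  have h1 := noEven_card_aux _ G rfl hG
  have h2 : (onTrail G).ncard ≤ Fintype.card V := by
    rw [← Nat.card_eq_fintype_card]; exact Set.ncard_le_card _
  omega

/-- alternating signed edge function of a walk -/
def altW {V : Type*} [DecidableEq V] {G : SimpleGraph V} : {u v : V} → G.Walk u v → Sym2 V → ℤ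
  | _, _, .nil, _ => 0
  | u, _, .cons (v := v) _ p, e => (if e = s(u, v) then 1 else 0) - altW p e

lemma altW_bound {V : Type*} [DecidableEq V] {G : SimpleGraph V} {u v : V} (p : G.Walk u v)
    (e : Sym2 V) : |altW p e| ≤ p.edges.count e := by
  induction p with
  | nil => simp [altW]
  | @cons a b _ h p ih =>
    simp only [altW, SimpleGraph.Walk.edges_cons, List.count_cons]
    rw [abs_le] at ih ⊢
    by_cases hc : e = s(a, b)
    · simp only [hc, if_true, beq_self_eq_true] at ih ⊢
      push_cast
      constructor <;> linarith [ih.1, ih.2]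
    · have hc' := Ne.symm hc
      simp only [hc, beq_iff_eq, hc', if_false] at ih ⊢
      push_cast
      constructor <;> linarith [ih.1, ih.2]

lemma altW_total {V : Type*} [Fintype V] [DecidableEq V] {G : SimpleGraph V} {u v : V}
    (p : G.Walk u v) : ∑ e, altW p e = if Even p.length then 0 else 1 := by
  induction p with
  | nil => simp [altW]
  | cons h p ih =>
    simp only [altW, Finset.sum_sub_distrib, ih, Finset.sum_ite_eq', Finset.mem_univ, if_true,
      SimpleGraph.Walk.length_cons, Nat.even_add_one]
    split_ifs <;> simp_all

lemma altW_vertex {V : Type*} [Fintype V] [DecidableEq V] {G : SimpleGraph V} {u v : V}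
    (p : G.Walk u v) (x : V) : ∑ e, (if x ∈ e then altW p e else 0) =
      (if x = u then 1 else 0) - (-1) ^ p.length * (if x = v then 1 else 0) := by
  induction p with
  | nil => simp [altW]
  | @cons a b c h p ih =>
    have : ∀ e : Sym2 V, (if x ∈ e then altW (.cons h p) e else 0) =
      (if e = s(a, b) then (if x ∈ s(a,b) then 1 else 0) else 0) 
        - (if x ∈ e then altW p e else 0) := by
      intro e
      simp only [altW]
      by_cases hc : e = s(a, b)
      · subst hc; by_cases hx : x ∈ s(a,b) <;> simp [hx]
      · by_cases hx : x ∈ e <;> simp [hx, hc]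
    rw [Finset.sum_congr rfl (fun e _ => this e), Finset.sum_sub_distrib, ih]
    have hab := h.ne
    simp only [Finset.sum_ite_eq', Finset.mem_univ, if_true, SimpleGraph.Walk.length_cons, pow_succ,
      Sym2.mem_iff]
    by_cases h1 : x = a <;> by_cases h2 : x = b
    · exact absurd (h1.symm.trans h2) hab
    all_goals simp [h1, h2, hab, hab.symm]
    all_goals split_ifs <;> ring

lemma exists_signing {V : Type*} [Fintype V] [DecidableEq V] {G : SimpleGraph V}
    (hG : ¬ NoEvenTrail G) : ∃ w : Sym2 V → ℤ, (∀ e, |w e| ≤ 1) ∧ (∀ e, w e ≠ 0 → e ∈ G.edgeSet) ∧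
      (∑ e, w e = 0) ∧ (∀ x, ∑ e, (if x ∈ e then w e else 0) = 0) ∧ ∃ e, w e ≠ 0 := by
  unfold NoEvenTrail at hG
  push Not at hG
  obtain ⟨u, p, hp, hl, hev⟩ := hG
  have hcount : ∀ e, p.edges.count e ≤ 1 := by
    rw [SimpleGraph.Walk.isTrail_def, List.nodup_iff_count_le_one] at hp
    exact hp
  refine ⟨altW p, fun e => (altW_bound p e).trans (by exact_mod_cast hcount e), ?_, ?_, ?_, ?_⟩
  · intro e he
    have h1 := altW_bound p e
    have h2 : 0 < |altW p e| := abs_pos.2 he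
    have h3 : 0 < p.edges.count e := by exact_mod_cast h2.trans_le h1
    exact p.edges_subset_edgeSet (List.count_pos_iff.1 h3)
  · rw [altW_total, if_pos hev]
  · intro x; rw [altW_vertex, hev.neg_one_pow]; simp
  · cases p with
    | nil => simp at hl
    | @cons _ y _ h q =>
      refine ⟨s(u, y), ?_⟩
      have hc := hcount s(u, y)
      simp at hc
      have h1 := altW_bound q s(u, y)
      rw [hc] at h1
      have h0 : altW q s(u, y) = 0 := by simpa using h1
      simp [altW, h0]

lemma defining_trade_free {v k : ℕ} {D : Finset (Finset (Fin v))} (hk : 2 ≤ k)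
    (hD : IsDefiningSetOn (Finset.univ : Finset (Fin v)) k D) (T : Finset (Fin v) → ℤ)
    (h1 : ∀ b, T b ≠ 0 → b.card = k) (h2 : ∀ b, -1 ≤ T b) (h3 : ∀ b, T b < 0 → b ∉ D)
    (h4 : ∀ i j, i ≠ j → ∑ b, (if i ∈ b ∧ j ∈ b then T b else 0) = 0) : ∀ b, T b = 0 := by
  obtain ⟨hsub, hun⟩ := hD
  let F := fullDesignOn (Finset.univ : Finset (Fin v)) k
  have hF : ∀ b, b ∈ F ↔ b.card = k := by intro b; simp [F, fullDesignOn]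
  let B : Multiset (Finset (Fin v)) := ∑ b ∈ F, Multiset.replicate (1 + T b).toNat b
  have hcount : ∀ b, B.count b = if b ∈ F then (1 + T b).toNat else 0 := by
    intro b
    simp only [B, Multiset.count_sum', Multiset.count_replicate, Finset.sum_ite_eq']
  have hdes : IsDesignOn (Finset.univ : Finset (Fin v)) k
      (((Finset.univ : Finset (Fin v)).card - 2).choose (k - 2)) B := by
    constructor
    · intro b hb
      refine ⟨Finset.subset_univ _, ?_⟩
      by_contra hc
      have := hcount b
      rw [if_neg (by rw [hF]; exact hc)] at this
      exact (Multiset.count_pos.2 hb).ne' this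
    · intro i _ j _ hij
      have e1 : Multiset.countP (fun b => i ∈ b ∧ j ∈ b) B =
          ∑ b ∈ F, if i ∈ b ∧ j ∈ b then (1 + T b).toNat else 0 := by
        simp only [B]
        have := map_sum (Multiset.countPAddMonoidHom (fun b : Finset (Fin v) => i ∈ b ∧ j ∈ b))
          (fun b => Multiset.replicate (1 + T b).toNat b) F
        simp only [Multiset.coe_countPAddMonoidHom] at this
        rw [this]
        refine Finset.sum_congr rfl fun b _ => ?_
        rw [← Multiset.coe_replicate, Multiset.coe_countP, List.countP_replicate]
        simp
      have e2 : ((F.filter (fun b => i ∈ b ∧ j ∈ b)).card : ℕ) =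
          ((Finset.univ : Finset (Fin v)).card - 2).choose (k - 2) := by
        have hc2 : ({i, j} : Finset (Fin v)).card = 2 := Finset.card_pair hij
        have := Finset.card_filter_powersetCard_subset ({i, j} : Finset (Fin v)) Finset.univ k
          (Finset.subset_univ _) (by omega)
        rw [hc2] at this
        rw [← this]
        congr 1
        ext b
        simp [F, fullDesignOn, Finset.insert_subset_iff]
      rw [e1, ← e2]
      have h5 : ((∑ b ∈ F, if i ∈ b ∧ j ∈ b then (1 + T b).toNat else 0 : ℕ) : ℤ) =
          ((F.filter (fun b => i ∈ b ∧ j ∈ b)).card : ℤ) := by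
        rw [Finset.card_filter]
        push_cast
        have h6 : ∑ b ∈ F, (if i ∈ b ∧ j ∈ b then T b else 0) = 0 := by
          refine Eq.trans ?_ (h4 i j hij)
          refine Finset.sum_subset (Finset.subset_univ _) fun b _ hb => ?_
          rw [hF] at hb
          have : T b = 0 := by
            by_contra hc; exact hb (h1 b hc)
          simp [this]
        rw [← sub_eq_zero, ← Finset.sum_sub_distrib]
        refine Eq.trans ?_ h6
        refine Finset.sum_congr rfl fun b _ => ?_
        have := h2 b
        split_ifs
        · omega
        · rfl
      exact_mod_cast h5
  have hle : D.val ≤ B := by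
    rw [Multiset.le_iff_count]
    intro b
    by_cases hb : b ∈ D
    · rw [Multiset.count_eq_one_of_mem D.nodup hb, hcount, if_pos (hsub hb)]
      have : ¬ T b < 0 := fun h => h3 b h hb
      omega
    · rw [Multiset.count_eq_zero_of_notMem hb]; exact Nat.zero_le _
  have hBF := hun B hdes hle
  intro b
  by_contra hb
  have hbF : b ∈ F := (hF b).2 (h1 b hb)
  have h7 := hcount b
  rw [hBF, if_pos hbF, Multiset.count_eq_one_of_mem F.nodup hbF] at h7
  have := h2 b
  omega

/-- The graph of pairs `xy` with `S ∪ {c,x,y}` and `S ∪ {d,x,y}` both outside `D`. -/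
def pairGraph {v : ℕ} (D : Finset (Finset (Fin v))) (S : Finset (Fin v)) (c d : Fin v) :
    SimpleGraph {x : Fin v // x ∉ S ∧ x ≠ c ∧ x ≠ d} where
  Adj x y := x ≠ y ∧ insert c (insert x.1 (insert y.1 S)) ∉ D ∧
    insert d (insert x.1 (insert y.1 S)) ∉ D
  symm := ⟨fun x y h => by
    rw [Finset.insert_comm y.1 x.1]
    exact ⟨h.1.symm, h.2⟩⟩
  loopless := ⟨fun x h => h.1 rfl⟩

lemma pairGraph_noEven {v k : ℕ} {D : Finset (Finset (Fin v))} (hk : 3 ≤ k)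
    (hD : IsDefiningSetOn (Finset.univ : Finset (Fin v)) k D) (S : Finset (Fin v))
    (hS : S.card = k - 3) (c d : Fin v) (hc : c ∉ S) (hd : d ∉ S) (hcd : c ≠ d) :
    NoEvenTrail (pairGraph D S c d) := by
  classical
  by_contra hcon
  obtain ⟨w, hw1, hw2, hw3, hw4, e0, he0⟩ := exists_signing hcon
  let V := {x : Fin v // x ∉ S ∧ x ≠ c ∧ x ≠ d}
  let φ : Fin v → Sym2 V → Finset (Fin v) := fun t e => insert t (S ∪ (e.map Subtype.val).toFinset)
  have hφ : ∀ t e z, z ∈ φ t e ↔ z = t ∨ z ∈ S ∨ ∃ x : V, x ∈ e ∧ x.1 = z := by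
    intro t e z
    simp only [φ, Finset.mem_insert, Finset.mem_union, Sym2.mem_toFinset, Sym2.mem_map]
    rfl
  have hφV : ∀ t (ht : t = c ∨ t = d) e (x : V), x.1 ∈ φ t e ↔ x ∈ e := by
    intro t ht e x
    rw [hφ]
    constructor
    · rintro (h | h | ⟨y, hy, hyx⟩)
      · rcases ht with rfl | rfl
        · exact absurd h x.2.2.1
        · exact absurd h x.2.2.2
      · exact absurd h x.2.1
      · rwa [← Subtype.ext hyx]
    · intro h; exact Or.inr (Or.inr ⟨x, h, rfl⟩)
  have hinj : ∀ t (ht : t = c ∨ t = d) e e', φ t e = φ t e' → e = e' := by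
    intro t ht e e' h
    refine Sym2.ext fun x => ?_
    rw [← hφV t ht, h, hφV t ht]
  have hφd : ∀ e, d ∉ φ c e := by
    intro e h
    rw [hφ] at h
    rcases h with h | h | ⟨y, hy, hyx⟩
    · exact hcd h.symm
    · exact hd h
    · exact y.2.2.2 hyx
  have hφc : ∀ e, c ∉ φ d e := by
    intro e h
    rw [hφ] at h
    rcases h with h | h | ⟨y, hy, hyx⟩
    · exact hcd h
    · exact hc h
    · exact y.2.2.1 hyx
  have hcc : ∀ t e, t ∈ φ t e := fun t e => by simp [φ]
  have hne : ∀ e e', φ c e ≠ φ d e' := by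
    intro e e' h
    exact hφd e (h ▸ hcc d e')
  have hcard : ∀ t (ht : t = c ∨ t = d) e, w e ≠ 0 → (φ t e).card = k ∧ φ t e ∉ D := by
    intro t ht e he
    have := hw2 e he
    induction e with | _ x y =>
    obtain ⟨hxy, h1, h2⟩ := this
    have hxy' : x.1 ≠ y.1 := fun h => hxy (Subtype.ext h)
    have hform : φ t s(x, y) = insert t (insert x.1 (insert y.1 S)) := by
      ext z
      simp only [φ, Sym2.map_mk, Sym2.toFinset_mk_eq, Finset.mem_insert, Finset.mem_union,
        Finset.mem_singleton]
      tauto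
    rw [hform]
    have hx := x.2
    have hy := y.2
    constructor
    · rw [Finset.card_insert_of_notMem, Finset.card_insert_of_notMem, Finset.card_insert_of_notMem]
      · omega
      · exact hy.1
      · simp [hxy', hx.1]
      · rcases ht with rfl | rfl
        · simp [hc, hx.2.1.symm, hy.2.1.symm]
        · simp [hd, hx.2.2.symm, hy.2.2.symm]
    · rcases ht with rfl | rfl
      · exact h1
      · exact h2
  let T : Finset (Fin v) → ℤ := fun b => ∑ e, w e * ((if b = φ c e then 1 else 0) - 
    (if b = φ d e then 1 else 0))
  have hTc : ∀ e, T (φ c e) = w e := by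
    intro e
    simp only [T]
    rw [Finset.sum_eq_single e]
    · simp [hne]
    · intro e' _ h'
      have : φ c e ≠ φ c e' := fun h => h' (hinj c (Or.inl rfl) _ _ h).symm
      simp [this, hne]
    · simp
  have hTd : ∀ e, T (φ d e) = - w e := by
    intro e
    simp only [T]
    rw [Finset.sum_eq_single e]
    · simp [(hne _ _).symm]
    · intro e' _ h'
      have : φ d e ≠ φ d e' := fun h => h' (hinj d (Or.inr rfl) _ _ h).symm
      simp [this, (hne _ _).symm]
    · simp
  have hT0 : ∀ b, T b ≠ 0 → ∃ e, b = φ c e ∨ b = φ d e := by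
    intro b hb
    by_contra hno
    push Not at hno
    apply hb
    simp only [T]
    exact Finset.sum_eq_zero fun e _ => by simp [(hno e).1, (hno e).2]
  have hfin := defining_trade_free (by omega) hD T ?_ ?_ ?_ ?_ (φ c e0)
  · rw [hTc] at hfin; exact he0 hfin
  · intro b hb
    obtain ⟨e, rfl | rfl⟩ := hT0 b hb
    · rw [hTc] at hb; exact (hcard c (Or.inl rfl) e hb).1
    · rw [hTd] at hb; exact (hcard d (Or.inr rfl) e (by simpa using hb)).1
  · intro b
    by_cases hb : T b = 0
    · omega
    obtain ⟨e, rfl | rfl⟩ := hT0 b hb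
    · rw [hTc]; exact (abs_le.1 (hw1 e)).1
    · rw [hTd]; have := (abs_le.1 (hw1 e)).2; omega
  · intro b hb
    obtain ⟨e, rfl | rfl⟩ := hT0 b hb.ne
    · rw [hTc] at hb; exact (hcard c (Or.inl rfl) e hb.ne).2
    · rw [hTd] at hb; exact (hcard d (Or.inr rfl) e (by omega)).2
  · intro i j hij
    have hswap : ∑ b, (if i ∈ b ∧ j ∈ b then T b else 0) =
        ∑ e, w e * ((if i ∈ φ c e ∧ j ∈ φ c e then 1 else 0) - 
          (if i ∈ φ d e ∧ j ∈ φ d e then 1 else 0)) := by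
      have : ∀ b, (if i ∈ b ∧ j ∈ b then T b else 0) = 
          ∑ e, (w e * ((if b = φ c e then (if i ∈ φ c e ∧ j ∈ φ c e then 1 else 0) else 0) - 
            (if b = φ d e then (if i ∈ φ d e ∧ j ∈ φ d e then 1 else 0) else 0))) := by
        intro b
        split_ifs with h
        · refine Finset.sum_congr rfl fun e _ => ?_
          congr 2
          · split_ifs with h1 h2
            · rfl
            · subst h1; exact absurd h h2
            · rfl
          · split_ifs with h1 h2
            · rfl
            · subst h1; exact absurd h h2
            · rfl
        · symm
          refine Finset.sum_eq_zero fun e _ => ?_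
          have a1 : (if b = φ c e then (if i ∈ φ c e ∧ j ∈ φ c e then (1:ℤ) else 0) else 0) = 0 := by
            split_ifs with h1 h2
            · subst h1; exact absurd h2 h
            · rfl
            · rfl
          have a2 : (if b = φ d e then (if i ∈ φ d e ∧ j ∈ φ d e then (1:ℤ) else 0) else 0) = 0 := by
            split_ifs with h1 h2
            · subst h1; exact absurd h2 h
            · rfl
            · rfl
          rw [a1, a2]; simp
      rw [Finset.sum_congr rfl fun b _ => this b, Finset.sum_comm]
      refine Finset.sum_congr rfl fun e _ => ?_
      rw [← Finset.mul_sum, Finset.sum_sub_distrib, Finset.sum_ite_eq', Finset.sum_ite_eq']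
      simp
    rw [hswap]
    -- single point sums
    have hpt : ∀ t (ht : t = c ∨ t = d) z, z ≠ c → z ≠ d →
        ∑ e, w e * (if z ∈ φ t e then 1 else 0) = 0 := by
      intro t ht z hz1 hz2
      by_cases hzS : z ∈ S
      · have : ∀ e, z ∈ φ t e := fun e => (hφ t e z).2 (Or.inr (Or.inl hzS))
        simp [this, hw3]
      · refine Eq.trans ?_ (hw4 ⟨z, hzS, hz1, hz2⟩)
        refine Finset.sum_congr rfl fun e _ => ?_
        have := hφV t ht e ⟨z, hzS, hz1, hz2⟩
        simp only at this
        simp only [this, mul_ite, mul_one, mul_zero]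
    have hgen : ∀ i j, i ≠ j → (i = c ∨ i = d) → 
        ∑ e, w e * ((if i ∈ φ c e ∧ j ∈ φ c e then 1 else 0) - 
          (if i ∈ φ d e ∧ j ∈ φ d e then 1 else 0)) = 0 := by
      intro i j hij hi
      by_cases hj : j = c ∨ j = d
      · refine Finset.sum_eq_zero fun e _ => ?_
        rcases hi with rfl | rfl <;> rcases hj with rfl | rfl
        · exact absurd rfl hij
        · simp [hφc, hφd]
        · simp [hφc, hφd]
        · exact absurd rfl hij
      · push Not at hj
        rcases hi with rfl | rfl
        · simpa [hφc, hφd, hcc] using hpt i (Or.inl rfl) j hj.1 hj.2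
        · simpa [hφc, hφd, hcc] using hpt i (Or.inr rfl) j hj.1 hj.2
    by_cases hi : i = c ∨ i = d
    · exact hgen i j hij hi
    by_cases hj : j = c ∨ j = d
    · refine Eq.trans ?_ (hgen j i hij.symm hj)
      simp only [and_comm]
    · push Not at hi hj
      refine Finset.sum_eq_zero fun e _ => ?_
      have hi' : i ∈ φ c e ↔ i ∈ φ d e := by rw [hφ, hφ]; simp [hi.1, hi.2]
      have hj' : j ∈ φ c e ↔ j ∈ φ d e := by rw [hφ, hφ]; simp [hj.1, hj.2]
      simp [hi', hj']

lemma pair_count {v k : ℕ} {D : Finset (Finset (Fin v))} (hk : 3 ≤ k) (hv : k + 1 ≤ v)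
    (hD : IsDefiningSetOn (Finset.univ : Finset (Fin v)) k D) (S : Finset (Fin v))
    (hS : S.card = k - 3) (c d : Fin v) (hc : c ∉ S) (hd : d ∉ S) (hcd : c ≠ d) :
    3 * ((Finset.univ : Finset (Fin v × Fin v)).filter (fun p => p.1 ∉ S ∧ p.2 ∉ S ∧ p.1 ≠ p.2 ∧ 
      p.1 ≠ c ∧ p.2 ≠ c ∧ p.1 ≠ d ∧ p.2 ≠ d ∧ 
      insert c (insert p.1 (insert p.2 S)) ∉ D ∧ insert d (insert p.1 (insert p.2 S)) ∉ D)).card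
      ≤ 8 * (v - k) + 2 := by
  classical
  have hne := pairGraph_noEven hk hD S hS c d hc hd hcd
  have hVcard : Fintype.card {x : Fin v // x ∉ S ∧ x ≠ c ∧ x ≠ d} = v - k + 1 := by
    rw [Fintype.card_subtype]
    have : (Finset.univ.filter (fun x : Fin v => x ∉ S ∧ x ≠ c ∧ x ≠ d)) =
        (insert c (insert d S))ᶜ := by
      ext x; simp; tauto
    rw [this, Finset.card_compl, Finset.card_insert_of_notMem (by simp [hc, hcd]), 
      Finset.card_insert_of_notMem hd, Fintype.card_fin]
    omega
  have : Nonempty {x : Fin v // x ∉ S ∧ x ≠ c ∧ x ≠ d} := 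
    Fintype.card_pos_iff.1 (by omega)
  have hb := noEven_card _ hne
  set G := pairGraph D S c d
  have h2 : (Finset.univ.filter (fun p : {x : Fin v // x ∉ S ∧ x ≠ c ∧ x ≠ d} × 
      {x : Fin v // x ∉ S ∧ x ≠ c ∧ x ≠ d} => G.Adj p.1 p.2)).card = 2 * G.edgeSet.ncard := by
    rw [← SimpleGraph.coe_edgeFinset, Set.ncard_coe_finset, 
      ← SimpleGraph.sum_degrees_eq_twice_card_edges, Finset.card_filter, Fintype.sum_prod_type]
    refine Finset.sum_congr rfl fun x _ => ?_
    rw [← Finset.card_filter, ← SimpleGraph.card_neighborFinset_eq_degree]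
    congr 1
    ext y; simp
  have h3 := Finset.card_le_card (t := (Finset.univ.filter (fun p : {x : Fin v // x ∉ S ∧ x ≠ c ∧ x ≠ d} × 
      {x : Fin v // x ∉ S ∧ x ≠ c ∧ x ≠ d} => G.Adj p.1 p.2)).image (fun p => (p.1.1, p.2.1))) 
      (s := (Finset.univ : Finset (Fin v × Fin v)).filter (fun p => p.1 ∉ S ∧ p.2 ∉ S ∧ p.1 ≠ p.2 ∧ 
      p.1 ≠ c ∧ p.2 ≠ c ∧ p.1 ≠ d ∧ p.2 ≠ d ∧ 
      insert c (insert p.1 (insert p.2 S)) ∉ D ∧ insert d (insert p.1 (insert p.2 S)) ∉ D)) (by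
    rintro ⟨x, y⟩ h
    simp only [Finset.mem_filter, Finset.mem_univ, true_and] at h
    obtain ⟨h1, h2, h3, h4, h5, h6, h7, h8, h9⟩ := h
    rw [Finset.mem_image]
    refine ⟨(⟨x, h1, h4, h6⟩, ⟨y, h2, h5, h7⟩), ?_, rfl⟩
    simp only [Finset.mem_filter, Finset.mem_univ, true_and]
    exact ⟨fun h => h3 (congrArg Subtype.val h), h8, h9⟩)
  have h4 := h3.trans Finset.card_image_le
  rw [h2] at h4
  omega

lemma ind_mul (p q : Prop) [Decidable p] [Decidable q] :
    (if p then (1 : ℝ) else 0) * (if q then 1 else 0) = if p ∧ q then 1 else 0 := by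
  by_cases hp : p <;> by_cases hq : q <;> simp [hp, hq]

lemma tri12 {α : Type*} [DecidableEq α] (a b c : α) : ({b, a, c} : Finset α) = {a, b, c} :=
  Finset.insert_comm _ _ _

lemma tri23 {α : Type*} [DecidableEq α] (a b c : α) : ({a, c, b} : Finset α) = {a, b, c} := by
  rw [Finset.pair_comm]

lemma ins3 {α : Type*} [DecidableEq α] (a b c : α) (S : Finset α) :
    insert c (insert a (insert b S)) = {a, b, c} ∪ S := by
  ext u
  simp only [Finset.mem_insert, Finset.mem_union, Finset.mem_singleton]
  tauto

lemma triple_bound {v k : ℕ} {D : Finset (Finset (Fin v))} (hk : 3 ≤ k) (hv : k + 1 ≤ v)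
    (hD : IsDefiningSetOn (Finset.univ : Finset (Fin v)) k D) (S : Finset (Fin v))
    (hS : S.card = k - 3) (N M : ℝ)
    (hN : N = ∑ a : Fin v, ∑ b : Fin v, ∑ c : Fin v, if (a ∉ S ∧ b ∉ S ∧ c ∉ S ∧ a ≠ b ∧ a ≠ c ∧
      b ≠ c ∧ insert c (insert a (insert b S)) ∉ D) then (1 : ℝ) else 0)
    (hM : M = ((v : ℝ) - k + 3) * ((v : ℝ) - k + 2)) :
    3 * N ^ 2 ≤ M * (3 * N + M * (8 * ((v : ℝ) - k) + 2)) := by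
  classical
  have hvk : (k : ℝ) + 1 ≤ v := by exact_mod_cast hv
  let g : Fin v → Fin v → Fin v → ℝ := fun a b c => if (a ∉ S ∧ b ∉ S ∧ c ∉ S ∧ a ≠ b ∧ a ≠ c ∧
      b ≠ c ∧ insert c (insert a (insert b S)) ∉ D) then (1 : ℝ) else 0
  have hsq : ∀ a b c, g a b c * g a b c = g a b c := by
    intro a b c; simp only [g]; split_ifs <;> simp
  let O := (Sᶜ).offDiag
  have hOc : (O.card : ℝ) = M := by
    have h1 : (Sᶜ).card = v - k + 3 := by
      rw [Finset.card_compl, Fintype.card_fin]; omega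
    simp only [O]
    rw [Finset.offDiag_card, h1, hM, Nat.cast_sub (Nat.le_mul_self _)]
    push_cast [Nat.cast_sub (show k ≤ v by omega)]
    ring
  have hsumO : ∀ F : Fin v → Fin v → ℝ, (∀ a b, (a, b) ∉ O → F a b = 0) →
      ∑ a, ∑ b, F a b = ∑ p ∈ O, F p.1 p.2 := by
    intro F hF
    rw [← Fintype.sum_prod_type']
    symm
    exact Finset.sum_subset (Finset.subset_univ _) fun p _ hp => hF _ _ hp
  have hmemO : ∀ a b, (a, b) ∈ O ↔ a ∉ S ∧ b ∉ S ∧ a ≠ b := by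
    intro a b; simp [O]
  let dg : Fin v → Fin v → ℝ := fun a b => ∑ c, g a b c
  have hdg : ∀ a b, (a, b) ∉ O → dg a b = 0 := by
    intro a b hab
    rw [hmemO] at hab
    refine Finset.sum_eq_zero fun c _ => ?_
    simp only [g]
    rw [if_neg (by tauto)]
  have hN1 : N = ∑ p ∈ O, dg p.1 p.2 := by
    rw [hN, ← hsumO dg hdg]
  have hCS : N ^ 2 ≤ M * ∑ p ∈ O, dg p.1 p.2 ^ 2 := by
    rw [hN1, ← hOc]
    exact sq_sum_le_card_mul_sum_sq
  have hexp : ∑ p ∈ O, dg p.1 p.2 ^ 2 = ∑ c, ∑ d, ∑ a, ∑ b, g a b c * g a b d := by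
    rw [← hsumO (fun a b => dg a b ^ 2) (fun a b h => by simp [hdg a b h])]
    have : ∀ a b, dg a b ^ 2 = ∑ c, ∑ d, g a b c * g a b d := by
      intro a b
      rw [sq, Finset.sum_mul_sum]
    simp only [this]
    rw [Finset.sum_congr rfl fun a _ => Finset.sum_comm, Finset.sum_comm]
    refine Finset.sum_congr rfl fun c _ => ?_
    rw [Finset.sum_congr rfl fun a _ => Finset.sum_comm, Finset.sum_comm]
  let E : Fin v → Fin v → ℝ := fun c d => ∑ a, ∑ b, g a b c * g a b d
  have hdiag : ∑ c, E c c = N := by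
    simp only [E, hsq]
    rw [hN, Finset.sum_comm]
    refine Finset.sum_congr rfl fun a _ => ?_
    rw [Finset.sum_comm]
  have hEO : ∀ c d, (c, d) ∈ O → 3 * E c d ≤ 8 * ((v : ℝ) - k) + 2 := by
    intro c d hcd
    rw [hmemO] at hcd
    have hp := pair_count hk hv hD S hS c d hcd.1 hcd.2.1 hcd.2.2
    have hE : E c d = (((Finset.univ : Finset (Fin v × Fin v)).filter (fun p => p.1 ∉ S ∧ p.2 ∉ S ∧
      p.1 ≠ p.2 ∧ p.1 ≠ c ∧ p.2 ≠ c ∧ p.1 ≠ d ∧ p.2 ≠ d ∧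
      insert c (insert p.1 (insert p.2 S)) ∉ D ∧
        insert d (insert p.1 (insert p.2 S)) ∉ D)).card : ℝ) := by
      simp only [E]
      rw [Finset.card_filter, ← Fintype.sum_prod_type']
      push_cast
      refine Finset.sum_congr rfl fun p _ => ?_
      simp only [g]
      rw [ind_mul]
      refine if_congr ?_ rfl rfl
      have := hcd.1
      have := hcd.2.1
      tauto
    rw [hE]
    have hp' : ((v - k : ℕ) : ℝ) = (v : ℝ) - k := by rw [Nat.cast_sub (by omega)]
    rw [← hp']
    exact_mod_cast hp
  have hE0 : ∀ c d, (c, d) ∉ O → c ≠ d → E c d = 0 := by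
    intro c d hcd hne
    rw [hmemO] at hcd
    refine Finset.sum_eq_zero fun a _ => Finset.sum_eq_zero fun b _ => ?_
    simp only [g]
    rw [ind_mul, if_neg (by tauto)]
  have hsplit : ∑ c, ∑ d, E c d = N + ∑ p ∈ O, E p.1 p.2 := by
    have h1 : ∀ c d, E c d = (if c = d then E c c else 0) + (if c = d then 0 else E c d) := by
      intro c d
      by_cases h : c = d
      · subst h; simp
      · simp [h]
    have h2 : ∑ c, ∑ d, E c d = ∑ c, ∑ d, (if c = d then E c c else 0) +
        ∑ c, ∑ d, (if c = d then 0 else E c d) := by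
      rw [← Finset.sum_add_distrib]
      refine Finset.sum_congr rfl fun c _ => ?_
      rw [← Finset.sum_add_distrib]
      exact Finset.sum_congr rfl fun d _ => h1 c d
    rw [h2, hsumO (fun c d => if c = d then 0 else E c d)]
    · congr 1
      · simp [hdiag]
      · refine Finset.sum_congr rfl fun p hp => ?_
        have := ((hmemO p.1 p.2).1 hp).2.2
        simp [this]
    · intro a b hab
      by_cases h : a = b
      · simp [h]
      · simp [h, hE0 a b hab h]
  have hbound : 3 * ∑ p ∈ O, E p.1 p.2 ≤ M * (8 * ((v : ℝ) - k) + 2) := by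
    rw [Finset.mul_sum, ← hOc, ← nsmul_eq_mul]
    exact Finset.sum_le_card_nsmul _ _ _ fun p hp => hEO p.1 p.2 hp
  have hM0 : 0 ≤ M := by rw [← hOc]; positivity
  rw [hexp] at hCS
  have : ∑ c, ∑ d, ∑ a, ∑ b, g a b c * g a b d = ∑ c, ∑ d, E c d := rfl
  rw [this, hsplit] at hCS
  nlinarith [mul_le_mul_of_nonneg_left hbound hM0]

lemma triple_count {v k : ℕ} (D : Finset (Finset (Fin v))) (hk : 3 ≤ k) (S : Finset (Fin v))
    (hS : S.card = k - 3) :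
    6 * (((((Finset.univ : Finset (Fin v)).powersetCard k) \ D).filter (S ⊆ ·)).card : ℝ) ≤
    ∑ a : Fin v, ∑ b : Fin v, ∑ c : Fin v, if (a ∉ S ∧ b ∉ S ∧ c ∉ S ∧ a ≠ b ∧ a ≠ c ∧
      b ≠ c ∧ insert c (insert a (insert b S)) ∉ D) then (1 : ℝ) else 0 := by
  classical
  let P : Fin v × Fin v × Fin v → Prop := fun t => (t.1 ∉ S ∧ t.2.1 ∉ S ∧ t.2.2 ∉ S ∧ t.1 ≠ t.2.1 ∧
    t.1 ≠ t.2.2 ∧ t.2.1 ≠ t.2.2 ∧ insert t.2.2 (insert t.1 (insert t.2.1 S)) ∉ D)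
  have h1 : (∑ a : Fin v, ∑ b : Fin v, ∑ c : Fin v, if (a ∉ S ∧ b ∉ S ∧ c ∉ S ∧ a ≠ b ∧ a ≠ c ∧
      b ≠ c ∧ insert c (insert a (insert b S)) ∉ D) then (1 : ℝ) else 0) =
      ((Finset.univ.filter P).card : ℝ) := by
    rw [Finset.card_filter, Fintype.sum_prod_type]
    simp only [Fintype.sum_prod_type]
    push_cast
    rfl
  rw [h1]
  set W := (((Finset.univ : Finset (Fin v)).powersetCard k) \ D).filter (S ⊆ ·)
  have hmap : ∀ t ∈ Finset.univ.filter P, insert t.2.2 (insert t.1 (insert t.2.1 S)) ∈ W := by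
    intro t ht
    simp only [Finset.mem_filter, Finset.mem_univ, true_and, P] at ht
    obtain ⟨h1, h2, h3, h4, h5, h6, h7⟩ := ht
    simp only [W, Finset.mem_filter, Finset.mem_sdiff, Finset.mem_powersetCard]
    refine ⟨⟨⟨Finset.subset_univ _, ?_⟩, h7⟩, ?_⟩
    · rw [Finset.card_insert_of_notMem, Finset.card_insert_of_notMem,
        Finset.card_insert_of_notMem h2]
      · omega
      · simp [h1, h4]
      · simp [h3, h5.symm, h6.symm]
    · intro z hz; simp [hz]
  have hfib := Finset.card_eq_sum_card_fiberwise hmap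
  have hge : W.card * 6 ≤ (Finset.univ.filter P).card := by
    rw [hfib, ← smul_eq_mul]
    refine Finset.card_nsmul_le_sum _ _ _ fun A hA => ?_
    simp only [W, Finset.mem_filter, Finset.mem_sdiff, Finset.mem_powersetCard] at hA
    obtain ⟨⟨⟨-, hAk⟩, hAD⟩, hSA⟩ := hA
    have h3 : (A \ S).card = 3 := by
      rw [Finset.card_sdiff_of_subset hSA]
      have := Finset.card_le_card hSA
      omega
    obtain ⟨x, y, z, hxy, hxz, hyz, hT⟩ := Finset.card_eq_three.1 h3
    have hA' : A = {x, y, z} ∪ S := by rw [← hT]; exact (Finset.sdiff_union_of_subset hSA).symm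
    have hx : x ∉ S := (Finset.mem_sdiff.1 (hT ▸ (by simp) : x ∈ A \ S)).2
    have hy : y ∉ S := (Finset.mem_sdiff.1 (hT ▸ (by simp) : y ∈ A \ S)).2
    have hz : z ∉ S := (Finset.mem_sdiff.1 (hT ▸ (by simp) : z ∈ A \ S)).2
    have hc6 : ({(x, y, z), (x, z, y), (y, x, z), (y, z, x), (z, x, y), (z, y, x)} :
        Finset (Fin v × Fin v × Fin v)).card = 6 := by
      simp [hxy, hxz, hyz, hxy.symm, hxz.symm, hyz.symm]
    rw [← hc6]
    refine Finset.card_le_card ?_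
    have gen : ∀ a b c : Fin v, a ∉ S → b ∉ S → c ∉ S → a ≠ b → a ≠ c → b ≠ c →
        ({a, b, c} : Finset (Fin v)) = {x, y, z} →
        P (a, b, c) ∧ insert c (insert a (insert b S)) = A := by
      intro a b c ha hb hc hab hac hbc he
      have : insert c (insert a (insert b S)) = A := by
        rw [hA', ← he, ins3]
      refine ⟨⟨ha, hb, hc, hab, hac, hbc, ?_⟩, this⟩
      simp only [this]
      exact hAD
    intro t ht
    simp only [Finset.mem_insert, Finset.mem_singleton] at ht
    simp only [Finset.mem_filter, Finset.mem_univ, true_and]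
    rcases ht with rfl | rfl | rfl | rfl | rfl | rfl
    · exact gen x y z hx hy hz hxy hxz hyz rfl
    · exact gen x z y hx hz hy hxz hxy hyz.symm (tri23 _ _ _)
    · exact gen y x z hy hx hz hxy.symm hyz hxz (tri12 _ _ _)
    · exact gen y z x hy hz hx hyz hxy.symm hxz.symm ((tri23 _ _ _).trans (tri12 _ _ _))
    · exact gen z x y hz hx hy hxz.symm hyz.symm hxy ((tri12 _ _ _).trans (tri23 _ _ _))
    · exact gen z y x hz hy hx hyz.symm hxz.symm hxy.symm ((tri23 _ _ _).trans ((tri12 _ _ _).trans (tri23 _ _ _)))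
  have : ((W.card * 6 : ℕ) : ℝ) ≤ ((Finset.univ.filter P).card : ℝ) := by exact_mod_cast hge
  push_cast at this
  linarith

lemma main_bound {v k : ℕ} {D : Finset (Finset (Fin v))} (hk : 3 ≤ k) (hv : k + 1 ≤ v)
    (hD : IsDefiningSetOn (Finset.univ : Finset (Fin v)) k D) :
    ((v.choose k : ℝ) - D.card) ≤ (v.choose k : ℝ) *
      ((1 + Real.sqrt ((32 * ((v : ℝ) - k) + 11) / 3)) / (2 * ((v : ℝ) - k + 1))) := by
  classical
  have hvk : (k : ℝ) + 1 ≤ v := by exact_mod_cast hv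
  set U := ((Finset.univ : Finset (Fin v)).powersetCard k) \ D with hU
  have hUc : (U.card : ℝ) = (v.choose k : ℝ) - D.card := by
    have hs : D ⊆ (Finset.univ : Finset (Fin v)).powersetCard k := hD.1
    rw [hU, Finset.card_sdiff_of_subset hs, Nat.cast_sub (Finset.card_le_card hs)]
    simp
  rw [← hUc]
  set s := Real.sqrt ((32 * ((v : ℝ) - k) + 11) / 3) with hs
  have hs2 : s ^ 2 = (32 * ((v : ℝ) - k) + 11) / 3 := Real.sq_sqrt (by linarith)
  have hs0 : 0 ≤ s := Real.sqrt_nonneg _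
  set X := (1 + s) / 2 with hX
  have hX2 : 3 * X ^ 2 - 3 * X = 8 * ((v : ℝ) - k) + 2 := by
    rw [hX]; linear_combination (3/4) * hs2
  have hX1 : 1 / 2 ≤ X := by rw [hX]; linarith
  set M := ((v : ℝ) - k + 3) * ((v : ℝ) - k + 2) with hM
  have hMpos : 0 < M := by rw [hM]; apply mul_pos <;> linarith
  have hS : ∀ S ∈ (Finset.univ : Finset (Fin v)).powersetCard (k - 3),
      6 * ((U.filter (S ⊆ ·)).card : ℝ) ≤ M * X := by
    intro S hS
    have hSc := (Finset.mem_powersetCard.1 hS).2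
    refine (triple_count D hk S hSc).trans ?_
    have hb := triple_bound hk hv hD S hSc _ M rfl hM
    set N := ∑ a : Fin v, ∑ b : Fin v, ∑ c : Fin v, if (a ∉ S ∧ b ∉ S ∧ c ∉ S ∧ a ≠ b ∧ a ≠ c ∧
      b ≠ c ∧ insert c (insert a (insert b S)) ∉ D) then (1 : ℝ) else 0
    rw [← hX2] at hb
    by_contra hcon
    push Not at hcon
    have h1 : 0 < N - M * X := by linarith
    have h2 : 0 < N + M * X - M := by nlinarith
    nlinarith [mul_pos h1 h2]
  have hdouble : ∑ S ∈ (Finset.univ : Finset (Fin v)).powersetCard (k - 3),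
      (U.filter (S ⊆ ·)).card = U.card * k.choose (k - 3) := by
    have := Finset.sum_card_bipartiteAbove_eq_sum_card_bipartiteBelow (fun S A : Finset (Fin v) => S ⊆ A)
      (s := (Finset.univ : Finset (Fin v)).powersetCard (k - 3)) (t := U)
    simp only [Finset.bipartiteAbove, Finset.bipartiteBelow] at this
    rw [this, ← smul_eq_mul]
    refine Finset.sum_eq_card_nsmul fun A hA => ?_
    have hAk : A.card = k := by
      rw [hU, Finset.mem_sdiff, Finset.mem_powersetCard] at hA
      exact hA.1.2
    rw [← hAk, ← Finset.card_powersetCard, hAk]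
    congr 1
    ext S
    simp [Finset.mem_powersetCard, and_comm]
  have hsum : 6 * ((U.card : ℝ) * k.choose (k - 3)) ≤ (v.choose (k - 3) : ℝ) * (M * X) := by
    have h1 := Finset.sum_le_card_nsmul _ _ _ hS
    rw [← Finset.mul_sum, Finset.card_powersetCard, Finset.card_univ, Fintype.card_fin,
      nsmul_eq_mul] at h1
    have h2 : (∑ S ∈ (Finset.univ : Finset (Fin v)).powersetCard (k - 3),
      ((U.filter (S ⊆ ·)).card : ℝ)) = (U.card : ℝ) * k.choose (k - 3) := by exact_mod_cast hdouble
    rw [h2] at h1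
    exact h1
  have hch : (v.choose (k - 3) : ℝ) * (M * ((v : ℝ) - k + 1)) =
      6 * ((v.choose k : ℝ) * k.choose (k - 3)) := by
    have h1 := Nat.choose_mul (n := v) (k := k) (s := k - 3) (by omega)
    have h2 : k - (k - 3) = 3 := by omega
    have h3 : v - (k - 3) = (v - k) + 3 := by omega
    rw [h2, h3] at h1
    have h4 : ((v - k : ℕ) : ℝ) = (v : ℝ) - k := by rw [Nat.cast_sub (by omega)]
    have h5 : 6 * (((v - k + 3).choose 3 : ℕ) : ℝ) = M * ((v : ℝ) - k + 1) := by
      rw [hM, ← h4]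
      have h6 := Nat.descFactorial_eq_factorial_mul_choose (v - k + 3) 3
      have h7 : (v - k + 3).descFactorial 3 = (v - k + 1) * ((v - k + 2) * (v - k + 3)) := by
        simp [Nat.descFactorial]
      rw [h7] at h6
      have h8 : (Nat.factorial 3) = 6 := rfl
      rw [h8] at h6
      have h9 : (((v - k : ℕ) : ℝ) + 1) * ((((v - k : ℕ) : ℝ) + 2) * (((v - k : ℕ) : ℝ) + 3)) =
        6 * (((v - k + 3).choose 3 : ℕ) : ℝ) := by exact_mod_cast h6
      rw [← h9]; ring
    have h10 : (v.choose k : ℝ) * k.choose (k - 3) = v.choose (k - 3) * ((v - k + 3).choose 3 : ℕ) := by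
      exact_mod_cast h1
    rw [h10, ← h5]; ring
  have hkc : (0 : ℝ) < k.choose (k - 3) := by exact_mod_cast Nat.choose_pos (by omega)
  have hm : (0 : ℝ) < (v : ℝ) - k + 1 := by linarith
  have hfin : (U.card : ℝ) * ((v : ℝ) - k + 1) ≤ (v.choose k : ℝ) * X := by
    have h1 := mul_le_mul_of_nonneg_right hsum hm.le
    have h2 : (v.choose (k - 3) : ℝ) * (M * X) * ((v : ℝ) - k + 1) =
        6 * ((v.choose k : ℝ) * k.choose (k - 3)) * X := by rw [← hch]; ring
    rw [h2] at h1
    have h3 : (6 * (k.choose (k - 3) : ℝ)) * ((U.card : ℝ) * ((v : ℝ) - k + 1)) ≤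
      (6 * (k.choose (k - 3) : ℝ)) * ((v.choose k : ℝ) * X) := by linarith
    exact le_of_mul_le_mul_left h3 (by positivity)
  have : (1 + s) / (2 * ((v : ℝ) - k + 1)) = X / ((v : ℝ) - k + 1) := by
    rw [hX]; field_simp
  rw [this, ← mul_div_assoc, le_div_iff₀ hm]
  exact hfin

/-- If `k ≥ 3`, `v ≥ k+1` and `D` is a defining set for the full design `F(v,k)`, then
`|D| ≥ C(v,k)·[1 − (1 + √((32(v−k)+11)/3))/(2(v−k+1))]`; in particular, there is an
absolute constant `C` such that `C(v,k) − |D| ≤ C · C(v,k) · (v−k)^{−1/2}` for all such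
`v`, `k` and `D`. -/
theorem definingSet_full_design_lower_bound :
    (∀ (v k : ℕ) (D : Finset (Finset (Fin v))), 3 ≤ k → k + 1 ≤ v →
      IsDefiningSetOn (Finset.univ : Finset (Fin v)) k D →
      (D.card : ℝ) ≥
        (v.choose k : ℝ) *
          (1 - (1 + Real.sqrt ((32 * ((v : ℝ) - k) + 11) / 3)) / (2 * ((v : ℝ) - k + 1)))) ∧
    ∃ C : ℝ, ∀ (v k : ℕ) (D : Finset (Finset (Fin v))), 3 ≤ k → k + 1 ≤ v →
      IsDefiningSetOn (Finset.univ : Finset (Fin v)) k D →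
      (v.choose k : ℝ) - (D.card : ℝ) ≤
        C * (v.choose k : ℝ) * ((v : ℝ) - k) ^ (-(1 : ℝ) / 2) := by

  constructor
  · intro v k D hk hv hD
    have := main_bound hk hv hD
    linarith
  · refine ⟨3, fun v k D hk hv hD => (main_bound hk hv hD).trans ?_⟩
    have hvk : (k : ℝ) + 1 ≤ v := by exact_mod_cast hv
    set n : ℝ := (v : ℝ) - k with hn
    have hn1 : 1 ≤ n := by linarith
    have hpow : n ^ (-(1 : ℝ) / 2) = (Real.sqrt n)⁻¹ := by
      rw [Real.sqrt_eq_rpow, ← Real.rpow_neg (by linarith)]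
      norm_num
    rw [hpow, mul_comm (3 : ℝ), mul_assoc]
    refine mul_le_mul_of_nonneg_left ?_ (by positivity)
    set r := Real.sqrt n with hr
    have hr2 : r ^ 2 = n := Real.sq_sqrt (by linarith)
    have hr1 : 1 ≤ r := Real.one_le_sqrt.2 hn1
    have hs : Real.sqrt ((32 * n + 11) / 3) ≤ 4 * r := by
      rw [Real.sqrt_le_left (by linarith)]
      nlinarith
    rw [← div_eq_mul_inv, div_le_div_iff₀ (by linarith) (by linarith)]
    nlinarith
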